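/- Assume that eAe'·e'Ae = {0} = e'Ae·eAe', that the bimodule eAe' is faithful as a left eAe-module (for a ∈ eAe, a·eAe' = {0} implies a = 0) and as a right e'Ae'-module (for b ∈ e'Ae', eAe'·b = {0} implies b = 0), and that either the ideal of the algebra eAe generated by all commutators [u, v] with u, v ∈ eAe equals eAe, or the ideal of the algebra e'Ae' generated by all commutators [u, v] with u, v ∈ e'Ae' equals e'Ae'. Then every Jordan biderivation J : A × A → A can be written as a sum of a biderivation and an antibiderivation. -/

import Mathlib

section JordanDerivation

variable {A : Type*} [Ring A]

/-- `x` lies in the Peirce corner `pAq`. -/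
def InPeirce (p q x : A) : Prop := p * x = x ∧ x * q = x

namespace InPeirce

variable {p q r s x y : A}

lemma mul (hx : InPeirce p q x) (hy : InPeirce r s y) : InPeirce p s (x * y) :=
  ⟨by rw [← mul_assoc, hx.1], by rw [mul_assoc, hy.2]⟩

lemma sub (hx : InPeirce p q x) (hy : InPeirce p q y) : InPeirce p q (x - y) :=
  ⟨by rw [mul_sub, hx.1, hy.1], by rw [sub_mul, hx.2, hy.2]⟩

lemma mul_eq_zero (hx : InPeirce p q x) (hy : InPeirce r s y) (h : q * r = 0) : x * y = 0 := by
  rw [← hx.2, ← hy.1, mul_assoc, ← mul_assoc q, h, zero_mul, mul_zero]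

lemma eq (hx : InPeirce p q x) : p * x * q = x := by rw [hx.1, hx.2]

lemma of_corner (hp : p * p = p) (hq : q * q = q) (x : A) : InPeirce p q (p * x * q) :=
  ⟨by rw [← mul_assoc, ← mul_assoc, hp], by rw [mul_assoc, hq]⟩

end InPeirce

/-- The defect of `d` from satisfying the Leibniz rule. -/
def leibnizDefect (d : A →+ A) (x y : A) : A := d (x * y) - d x * y - x * d y

section leibnizDefect

variable {d : A →+ A}

lemma leibnizDefect_add_left (x y z : A) :
    leibnizDefect d (x + y) z = leibnizDefect d x z + leibnizDefect d y z := by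
  simp only [leibnizDefect, add_mul, map_add]; abel

lemma leibnizDefect_add_right (x y z : A) :
    leibnizDefect d x (y + z) = leibnizDefect d x y + leibnizDefect d x z := by
  simp only [leibnizDefect, mul_add, map_add]; abel

lemma leibnizDefect_cocycle (x y z : A) :
    leibnizDefect d (x * y) z + leibnizDefect d x y * z =
      leibnizDefect d x (y * z) + x * leibnizDefect d y z := by
  simp only [leibnizDefect, mul_assoc, sub_mul, mul_sub]; abel

lemma map_jordan_mul (hd : ∀ x, d (x * x) = x * d x + d x * x) (x y : A) :
    d (x * y) + d (y * x) = x * d y + d x * y + y * d x + d y * x := by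
  have h := hd (x + y)
  simp only [add_mul, mul_add, map_add, hd] at h
  grind

lemma leibnizDefect_swap (hd : ∀ x, d (x * x) = x * d x + d x * x) {x y : A}
    (h : leibnizDefect d x y = 0) : leibnizDefect d y x = 0 := by
  have := map_jordan_mul hd x y
  unfold leibnizDefect at *
  grind

lemma leibnizDefect_eq_zero_of_orthogonal {p q r s x y : A} (hx : InPeirce p q x)
    (hy : InPeirce r s y) (hdx : InPeirce p q (d x)) (hdy : InPeirce r s (d y))
    (h : q * r = 0) : leibnizDefect d x y = 0 := by
  rw [leibnizDefect, hx.mul_eq_zero hy h, hdx.mul_eq_zero hy h, hx.mul_eq_zero hdy h]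
  simp

end leibnizDefect

section Peirce

variable {d : A →+ A} {e f : A}

lemma InPeirce.map_diag (htf : ∀ x : A, x + x = 0 → x = 0)
    (hd : ∀ x, d (x * x) = x * d x + d x * x) (he : e * e = e) (hde : d e = 0) {a : A}
    (ha : InPeirce e e a) : InPeirce e e (d a) := by
  have h := map_jordan_mul hd e a
  rw [ha.1, ha.2, hde] at h
  simp only [zero_mul, mul_zero, add_zero] at h
  have hl : e * d a = e * d a * e := by
    have := congrArg (e * ·) h
    simp only [mul_add, ← mul_assoc, he] at this
    exact add_left_cancel this
  have hr : d a * e = e * d a * e := by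
    have := congrArg (· * e) h
    simp only [add_mul, mul_assoc, he] at this
    rw [mul_assoc]
    exact add_right_cancel this
  have key : d a = e * d a * e :=
    sub_eq_zero.1 (htf _ (by rw [sub_add_sub_comm, h, ← hl, hr, ← hl, sub_self]))
  exact ⟨by rw [hl, ← key], by rw [hr, ← key]⟩

lemma map_offdiag (hd : ∀ x, d (x * x) = x * d x + d x * x) (hfe : f * e = 0)
    (hde : d e = 0) {m : A} (hm : InPeirce e f m) : d m = e * d m + d m * e := by
  have h := map_jordan_mul hd e m
  have hme : m * e = 0 := by rw [← hm.2, mul_assoc, hfe, mul_zero]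
  rw [hm.1, hme, hde] at h
  simpa using h

lemma mul_map_offdiag_mul (hd : ∀ x, d (x * x) = x * d x + d x * x) (he : e * e = e)
    (hfe : f * e = 0) (hde : d e = 0) {m : A} (hm : InPeirce e f m) : e * (d m * e) = 0 := by
  have h := congrArg (e * ·) (map_offdiag hd hfe hde hm)
  simp only [mul_add, ← mul_assoc, he] at h
  rw [← mul_assoc]
  exact left_eq_add.1 h

lemma map_left_mul_offdiag (htf : ∀ x : A, x + x = 0 → x = 0)
    (hd : ∀ x, d (x * x) = x * d x + d x * x) (he : e * e = e) (hfe : f * e = 0)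
    (hde : d e = 0) {a m : A} (ha : InPeirce e e a) (hm : InPeirce e f m) :
    d (a * m) * e = d m * e * a := by
  have h := congrArg (· * e) (map_jordan_mul hd a m)
  have hda := ha.map_diag htf hd he hde
  have hme : m * e = 0 := by rw [← hm.2, mul_assoc, hfe, mul_zero]
  have ham : a * (d m * e) = 0 := by
    rw [← ha.2, mul_assoc, mul_map_offdiag_mul hd he hfe hde hm, mul_zero]
  rw [hm.mul_eq_zero ha hfe, hm.mul_eq_zero hda hfe, map_zero, add_zero, add_zero] at h
  simpa only [add_mul, mul_assoc, hme, ham, ha.1, ha.2, mul_zero, zero_add] using h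

lemma map_offdiag_mul_right (htf : ∀ x : A, x + x = 0 → x = 0)
    (hd : ∀ x, d (x * x) = x * d x + d x * x) (hf : f * f = f)
    (hfe : f * e = 0) (hdf : d f = 0) {b m : A}
    (hb : InPeirce f f b) (hm : InPeirce e f m) :
    d (m * b) * e = b * (d m * e) := by
  have h := congrArg (· * e) (map_jordan_mul hd m b)
  have hdb := hb.map_diag htf hd hf hdf
  have hbe : b * e = 0 := by rw [← hb.2, mul_assoc, hfe, mul_zero]
  have hdbe : d b * e = 0 := by rw [← hdb.2, mul_assoc, hfe, mul_zero]
  rw [hb.mul_eq_zero hm hfe, hdb.mul_eq_zero hm hfe, map_zero, add_zero, add_zero] at h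
  simpa only [add_mul, mul_assoc, hbe, hdbe, mul_zero, zero_add] using h

/-- The ideal of the corner algebra `eAe` generated by its commutators is all of `eAe`. -/
def CommutatorIdealEqTop (R : Type*) [CommRing R] [Algebra R A] (e : A) : Prop :=
  ∀ w : A, e * w * e ∈ Submodule.span R
    {z : A | ∃ x u v y : A, z = (e * x * e) *
      ((e * u * e) * (e * v * e) - (e * v * e) * (e * u * e)) * (e * y * e)}

lemma InPeirce.map_offdiag {R : Type*} [CommRing R] [Algebra R A]
    (htf : ∀ x : A, x + x = 0 → x = 0) (hd : ∀ x, d (x * x) = x * d x + d x * x)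
    (he : e * e = e) (hf : f * f = f) (hfe : f * e = 0) (h1 : e + f = 1)
    (hde : d e = 0) (hdf : d f = 0)
    (hid : CommutatorIdealEqTop R e ∨ CommutatorIdealEqTop R f) {m : A}
    (hm : InPeirce e f m) : InPeirce e f (d m) := by
  have h0 : d m * e = 0 := by
    rcases hid with hid | hid
    · have H {a n : A} (ha : InPeirce e e a) (hn : InPeirce e f n) :
          d (a * n) * e = d n * e * a := map_left_mul_offdiag htf hd he hfe hde ha hn
      have hs : ∀ z ∈ Submodule.span R {z : A | ∃ x u v y : A, z = (e * x * e) *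
          ((e * u * e) * (e * v * e) - (e * v * e) * (e * u * e)) * (e * y * e)},
          d m * e * z = 0 := by
        intro z hz
        induction hz using Submodule.span_induction with
        | mem z hz =>
          obtain ⟨x, u, v, y, rfl⟩ := hz
          have hx := InPeirce.of_corner he he x
          have hu := InPeirce.of_corner he he u
          have hv := InPeirce.of_corner he he v
          have hxm := hx.mul hm
          have hc := H (hv.mul hu) hxm
          rw [mul_assoc (e * v * e), H hv (hu.mul hxm), H hu hxm] at hc
          rw [← mul_assoc, ← mul_assoc (d m * e) (e * x * e), ← H hx hm, mul_sub, ← hc,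
            ← mul_assoc _ (e * u * e), sub_self, zero_mul]
        | zero => exact mul_zero _
        | add x y _ _ hx hy => rw [mul_add, hx, hy, add_zero]
        | smul r x _ hx => rw [mul_smul_comm, hx, smul_zero]
      simpa [mul_assoc, he] using hs _ (hid 1)
    · have H {b n : A} (hb : InPeirce f f b) (hn : InPeirce e f n) :
          d (n * b) * e = b * (d n * e) := map_offdiag_mul_right htf hd hf hfe hdf hb hn
      have hs : ∀ z ∈ Submodule.span R {z : A | ∃ x u v y : A, z = (f * x * f) *
          ((f * u * f) * (f * v * f) - (f * v * f) * (f * u * f)) * (f * y * f)},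
          z * (d m * e) = 0 := by
        intro z hz
        induction hz using Submodule.span_induction with
        | mem z hz =>
          obtain ⟨x, u, v, y, rfl⟩ := hz
          have hy := InPeirce.of_corner hf hf y
          have hu := InPeirce.of_corner hf hf u
          have hv := InPeirce.of_corner hf hf v
          have hmy := hm.mul hy
          have hc := H (hv.mul hu) hmy
          rw [← mul_assoc _ (f * v * f), H hu (hmy.mul hv), H hv hmy] at hc
          rw [mul_assoc, ← H hy hm, mul_assoc, sub_mul, ← hc, mul_assoc (f * u * f), sub_self,
            mul_zero]
        | zero => exact zero_mul _
        | add x y _ _ hx hy => rw [add_mul, hx, hy, add_zero]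
        | smul r x _ hx => rw [smul_mul_assoc, hx, smul_zero]
      have hfm : f * (d m * e) = 0 := by simpa [mul_assoc, hf, ← mul_assoc f f] using hs _ (hid 1)
      rw [← one_mul (d m * e), ← h1, add_mul, hfm, mul_map_offdiag_mul hd he hfe hde hm, add_zero]
  have h := _root_.map_offdiag hd hfe hde hm
  rw [h0, add_zero] at h
  exact ⟨h.symm, by rw [← add_zero (d m * f), ← h0, add_comm, ← mul_add, h1, mul_one]⟩

/-- A Jordan derivation vanishing at `e` and `f` is a derivation. -/
lemma leibnizDefect_eq_zero_of_map_idempotent {R : Type*} [CommRing R] [Algebra R A]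
    (htf : ∀ x : A, x + x = 0 → x = 0) (hd : ∀ x, d (x * x) = x * d x + d x * x)
    (he : e * e = e) (hf : f * f = f) (hef : e * f = 0) (hfe : f * e = 0) (h1 : e + f = 1)
    (hde : d e = 0) (hdf : d f = 0)
    (hz1 : ∀ x y : A, (e * x * f) * (f * y * e) = 0)
    (hz2 : ∀ x y : A, (f * x * e) * (e * y * f) = 0)
    (hfl : ∀ x : A, (∀ y : A, (e * x * e) * (e * y * f) = 0) → e * x * e = 0)
    (hfr : ∀ x : A, (∀ y : A, (e * y * f) * (f * x * f) = 0) → f * x * f = 0)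
    (hid : CommutatorIdealEqTop R e ∨ CommutatorIdealEqTop R f) (x y : A) :
    leibnizDefect d x y = 0 := by
  have dee {a : A} (ha : InPeirce e e a) := ha.map_diag htf hd he hde
  have dff {a : A} (ha : InPeirce f f a) := ha.map_diag htf hd hf hdf
  have dmm {a : A} (ha : InPeirce e f a) :=
    ha.map_offdiag htf hd he hf hfe h1 hde hdf hid
  have dnn {a : A} (ha : InPeirce f e a) :=
    ha.map_offdiag htf hd hf he hef (by rw [add_comm, h1]) hdf hde hid.symm
  have hee := InPeirce.of_corner he he
  have hff := InPeirce.of_corner hf hf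
  have hmm := InPeirce.of_corner he hf
  have hnn := InPeirce.of_corner hf he
  have mn {m n : A} (hm : InPeirce e f m) (hn : InPeirce f e n) : m * n = 0 := by
    rw [← hm.eq, ← hn.eq, hz1]
  have nm {m n : A} (hm : InPeirce e f m) (hn : InPeirce f e n) : n * m = 0 := by
    rw [← hm.eq, ← hn.eq, hz2]
  have em {a m : A} (ha : InPeirce e e a) (hm : InPeirce e f m) : leibnizDefect d a m = 0 :=
    leibnizDefect_swap hd (leibnizDefect_eq_zero_of_orthogonal hm ha (dmm hm) (dee ha) hfe)
  have mf {b m : A} (hm : InPeirce e f m) (hb : InPeirce f f b) : leibnizDefect d m b = 0 :=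
    leibnizDefect_swap hd (leibnizDefect_eq_zero_of_orthogonal hb hm (dff hb) (dmm hm) hfe)
  have ee {a b : A} (ha : InPeirce e e a) (hb : InPeirce e e b) : leibnizDefect d a b = 0 := by
    have hP : InPeirce e e (leibnizDefect d a b) :=
      ((dee (ha.mul hb)).sub ((dee ha).mul hb)).sub (ha.mul (dee hb))
    rw [← hP.eq]
    refine hfl _ fun m ↦ ?_
    have := leibnizDefect_cocycle (d := d) a b (e * m * f)
    rwa [em (ha.mul hb) (hmm m), em ha (hb.mul (hmm m)), em hb (hmm m), zero_add, mul_zero,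
      zero_add, ← hP.eq] at this
  have ff {a b : A} (ha : InPeirce f f a) (hb : InPeirce f f b) : leibnizDefect d a b = 0 := by
    have hP : InPeirce f f (leibnizDefect d a b) :=
      ((dff (ha.mul hb)).sub ((dff ha).mul hb)).sub (ha.mul (dff hb))
    rw [← hP.eq]
    refine hfr _ fun m ↦ ?_
    have := leibnizDefect_cocycle (d := d) (e * m * f) a b
    rw [mf ((hmm m).mul ha) hb, mf (hmm m) ha, mf (hmm m) (ha.mul hb), zero_mul, zero_add,
      zero_add, ← hP.eq] at this
    exact this.symm
  have orth {p q r s x y : A} (hx : InPeirce p q x) (hy : InPeirce r s y)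
      (hdx : InPeirce p q (d x)) (hdy : InPeirce r s (d y)) (h : q * r = 0) :=
    leibnizDefect_eq_zero_of_orthogonal hx hy hdx hdy h
  have decomp (x : A) : x = e * x * e + e * x * f + (f * x * e + f * x * f) := by
    rw [← mul_add, ← mul_add, h1, mul_one, mul_one, ← add_mul, h1, one_mul]
  have pmn {m n : A} (hm : InPeirce e f m) (hn : InPeirce f e n) : leibnizDefect d m n = 0 := by
    rw [leibnizDefect, mn hm hn, mn (dmm hm) hn, mn hm (dnn hn)]; simp
  rw [decomp x, decomp y]
  simp only [leibnizDefect_add_left, leibnizDefect_add_right]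
  rw [ee (hee x) (hee y), em (hee x) (hmm y), ff (hff x) (hff y), mf (hmm x) (hff y),
    pmn (hmm x) (hnn y), leibnizDefect_swap hd (pmn (hmm y) (hnn x)),
    orth (hee x) (hnn y) (dee (hee x)) (dnn (hnn y)) hef,
    orth (hee x) (hff y) (dee (hee x)) (dff (hff y)) hef,
    orth (hmm x) (hee y) (dmm (hmm x)) (dee (hee y)) hfe,
    orth (hmm x) (hmm y) (dmm (hmm x)) (dmm (hmm y)) hfe,
    orth (hnn x) (hnn y) (dnn (hnn x)) (dnn (hnn y)) hef,
    orth (hnn x) (hff y) (dnn (hnn x)) (dff (hff y)) hef,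
    orth (hff x) (hee y) (dff (hff x)) (dee (hee y)) hfe,
    orth (hff x) (hmm y) (dff (hff x)) (dmm (hmm y)) hfe,
    leibnizDefect_swap hd (orth (hee y) (hnn x) (dee (hee y)) (dnn (hnn x)) hef),
    leibnizDefect_swap hd (orth (hnn y) (hff x) (dnn (hnn y)) (dff (hff x)) hef)]
  simp

/-- Every Jordan derivation is a derivation, provided that the Peirce corners `eAf` and `fAe`
annihilate each other, `eAf` is faithful on both sides, and one of the diagonal corners is
generated as an ideal by its commutators. -/
theorem jordanDerivation_leibniz {R : Type*} [CommRing R] [Algebra R A]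
    (htf : ∀ x : A, x + x = 0 → x = 0) (hd : ∀ x, d (x * x) = x * d x + d x * x)
    (he : e * e = e) (h1 : e + f = 1)
    (hz1 : ∀ x y : A, (e * x * f) * (f * y * e) = 0)
    (hz2 : ∀ x y : A, (f * x * e) * (e * y * f) = 0)
    (hfl : ∀ x : A, (∀ y : A, (e * x * e) * (e * y * f) = 0) → e * x * e = 0)
    (hfr : ∀ x : A, (∀ y : A, (e * y * f) * (f * x * f) = 0) → f * x * f = 0)
    (hid : CommutatorIdealEqTop R e ∨ CommutatorIdealEqTop R f) (x y : A) :
    d (x * y) = d x * y + x * d y := by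
  have hf' : f = 1 - e := eq_sub_of_add_eq' h1
  have hef : e * f = 0 := by rw [hf', mul_sub, he, mul_one, sub_self]
  have hfe : f * e = 0 := by rw [hf', sub_mul, he, one_mul, sub_self]
  have hf : f * f = f := by
    conv_rhs => rw [← one_mul f, ← h1, add_mul, hef, zero_add]
  have hede : e * d e * e = 0 := by
    have h := congrArg (e * ·) (hd e)
    simp only [he, mul_add, ← mul_assoc] at h
    exact left_eq_add.1 h
  -- subtracting an inner derivation makes the Jordan derivation vanish at `e`
  let c := e * d e - d e * e
  let δ : A →+ A := d - (AddMonoidHom.mulRight c - AddMonoidHom.mulLeft c)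
  have hδ (x : A) : δ x = d x - (x * c - c * x) := rfl
  have hδd (x : A) : δ (x * x) = x * δ x + δ x * x := by
    simp only [hδ, hd]; noncomm_ring
  have hδe : δ e = 0 := by
    have h2 : e * c - c * e = e * d e + d e * e := by
      simp only [c, mul_sub, sub_mul, ← mul_assoc, he, hede]
      simp only [mul_assoc, he]
      abel
    have h := hd e
    rw [he] at h
    rw [hδ, h2, ← h, sub_self]
  have hδ1 : δ 1 = 0 := by simpa using hδd 1
  have hδf : δ f = 0 := by rw [hf', map_sub, hδ1, hδe, sub_self]
  have h := leibnizDefect_eq_zero_of_map_idempotent htf hδd he hf hef hfe h1 hδe hδf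
    hz1 hz2 hfl hfr hid x y
  rw [leibnizDefect, sub_sub, sub_eq_zero] at h
  simp only [hδ, mul_sub, sub_mul, mul_assoc] at h
  grind

end Peirce

end JordanDerivation


/-- Assume `eAe'·e'Ae = {0} = e'Ae·eAe'`, that `eAe'` is faithful as a
left `eAe`-module and as a right `e'Ae'`-module, and that either the ideal of the
algebra `eAe` generated by all commutators `[u,v]` (`u, v ∈ eAe`) equals `eAe`, or the
ideal of the algebra `e'Ae'` generated by all commutators `[u,v]` (`u, v ∈ e'Ae'`)
equals `e'Ae'` (`e' = 1 - e`).  Then every Jordan biderivation `J : A × A → A` can be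
written as a sum of a biderivation and an antibiderivation. -/
theorem jordan_biderivation_sum_bider_antibider_faithful
    (R A : Type*) [CommRing R] [Ring A] [Algebra R A]
    -- `A` is 2-torsion free:
    (htf : ∀ x : A, x + x = 0 → x = 0)
    -- `e` is a nontrivial idempotent:
    (e : A) (he : e * e = e) (he0 : e ≠ 0) (he1 : e ≠ 1)
    -- `eAe'·e'Ae = {0} = e'Ae·eAe'`:
    (hz1 : ∀ x y : A, (e * x * (1 - e)) * ((1 - e) * y * e) = 0)
    (hz2 : ∀ x y : A, ((1 - e) * x * e) * (e * y * (1 - e)) = 0)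
    -- `eAe'` is a faithful left `eAe`-module:
    (hfl : ∀ x : A, (∀ y : A, (e * x * e) * (e * y * (1 - e)) = 0) → e * x * e = 0)
    -- `eAe'` is a faithful right `e'Ae'`-module:
    (hfr : ∀ x : A, (∀ y : A, (e * y * (1 - e)) * ((1 - e) * x * (1 - e)) = 0) →
      (1 - e) * x * (1 - e) = 0)
    -- `Id([eAe, eAe]) = eAe` or `Id([e'Ae', e'Ae']) = e'Ae'`:
    (hid : (∀ w : A, e * w * e ∈ Submodule.span R
              {z : A | ∃ x u v y : A, z = (e * x * e) *
                ((e * u * e) * (e * v * e) - (e * v * e) * (e * u * e)) * (e * y * e)})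
         ∨ (∀ w : A, (1 - e) * w * (1 - e) ∈ Submodule.span R
              {z : A | ∃ x u v y : A, z = ((1 - e) * x * (1 - e)) *
                (((1 - e) * u * (1 - e)) * ((1 - e) * v * (1 - e))
                  - ((1 - e) * v * (1 - e)) * ((1 - e) * u * (1 - e)))
                * ((1 - e) * y * (1 - e))}))
    (J : A →ₗ[R] A →ₗ[R] A)
    -- `J` is a Jordan biderivation:
    (hJ1 : ∀ x y : A, J (x * x) y = x * J x y + J x y * x)
    (hJ2 : ∀ x y : A, J x (y * y) = y * J x y + J x y * y) :
    ∃ D Δ : A →ₗ[R] A →ₗ[R] A,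
      -- `D` is a biderivation:
      (∀ x y z : A, D (x * y) z = D x z * y + x * D y z) ∧
      (∀ x y z : A, D z (x * y) = D z x * y + x * D z y) ∧
      -- `Δ` is an antibiderivation:
      (∀ x y z : A, Δ (x * y) z = Δ y z * x + y * Δ x z) ∧
      (∀ x y z : A, Δ z (x * y) = Δ z y * x + y * Δ z x) ∧
      -- `J = D + Δ`:
      (∀ x y : A, J x y = D x y + Δ x y) := by
  have leibniz (d : A →+ A) (hd : ∀ x, d (x * x) = x * d x + d x * x) (x y : A) :
      d (x * y) = d x * y + x * d y :=
    jordanDerivation_leibniz htf hd he (add_sub_cancel e 1) hz1 hz2 hfl hfr hid x y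
  refine ⟨J, 0, fun x y z ↦ leibniz (J.flip z).toAddMonoidHom (fun x ↦ hJ1 x z) x y,
    fun x y z ↦ leibniz (J z).toAddMonoidHom (hJ2 z) x y, ?_, ?_, ?_⟩ <;> simp
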